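/- arXiv:2402.13621 — 4 statements merged into one kernel-verified Lean document; each statement's English description precedes it below -/
import Mathlib

section
/- Let n be a positive integer and let I be a subset of the set of prime divisors of n. Then, as rational numbers, Σ_{1 ≤ i ≤ n−1, p ∤ i for all p ∈ I} i(n−i) = (1/6)·n·(∏_{p ∈ I} (1 − 1/p))·(n² + (−1)^{|I|+1}·∏_{p ∈ I} p). -/
theorem sum_base_aux (n : ℕ) (x : ℚ) :
    ∑ i ∈ Finset.range n, ((i : ℚ) * (x - (i : ℚ))) =
      x * (n * (n - 1) / 2) - (n - 1) * n * (2 * n - 1) / 6 := by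
  induction n with
  | zero => simp
  | succ k ih => rw [Finset.sum_range_succ, ih]; push_cast; ring

theorem sum_main_aux (I : Finset ℕ) : ∀ n : ℕ, 0 < n → I ⊆ n.primeFactors →
    ∑ i ∈ (Finset.range n).filter (fun i => ∀ p ∈ I, ¬ p ∣ i), ((i : ℚ) * ((n : ℚ) - (i : ℚ))) =
      (1 / 6 : ℚ) * (n : ℚ) * (∏ p ∈ I, (1 - 1 / (p : ℚ))) *
        ((n : ℚ) ^ 2 + (-1 : ℚ) ^ (I.card + 1) * ∏ p ∈ I, (p : ℚ)) := by
  induction I using Finset.induction_on with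
  | empty =>
    intro n hn _
    simp only [Finset.notMem_empty, false_imp_iff, implies_true, Finset.filter_true]
    rw [sum_base_aux]
    simp
    ring
  | insert q I hq ih =>
    intro n hn hI
    have hqn := hI (Finset.mem_insert_self q I)
    have hqp : q.Prime := Nat.prime_of_mem_primeFactors hqn
    obtain ⟨m, rfl⟩ := Nat.dvd_of_mem_primeFactors hqn
    have hm : 0 < m := Nat.pos_of_mul_pos_left hn
    have hI' : I ⊆ (q * m).primeFactors := fun p hp => hI (Finset.mem_insert_of_mem hp)
    have hcop : ∀ p ∈ I, ∀ j, p ∣ q * j ↔ p ∣ j := by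
      intro p hp j
      have hpp : p.Prime := Nat.prime_of_mem_primeFactors (hI' hp)
      have hne : p ≠ q := fun h => hq (h ▸ hp)
      exact ((Nat.coprime_primes hpp hqp).2 hne).dvd_mul_left
    have hIm : I ⊆ m.primeFactors := by
      intro p hp
      have h := hI' hp
      rw [Nat.mem_primeFactors] at h ⊢
      exact ⟨h.1, (hcop p hp m).1 h.2.1, hm.ne'⟩
    have h1 := ih (q * m) hn hI'
    have h2 := ih m hm hIm
    have h3 := Finset.sum_filter_add_sum_filter_not
      ((Finset.range (q * m)).filter (fun i => ∀ p ∈ I, ¬ p ∣ i)) (fun i => q ∣ i)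
      (fun i => ((i : ℚ) * (((q * m : ℕ) : ℚ) - (i : ℚ))))
    have h4 : ∑ i ∈ ((Finset.range (q * m)).filter (fun i => ∀ p ∈ I, ¬ p ∣ i)).filter
        (fun i => q ∣ i), ((i : ℚ) * (((q * m : ℕ) : ℚ) - (i : ℚ))) =
        (q : ℚ) ^ 2 * ∑ i ∈ (Finset.range m).filter (fun i => ∀ p ∈ I, ¬ p ∣ i),
          ((i : ℚ) * ((m : ℚ) - (i : ℚ))) := by
      rw [Finset.mul_sum]
      symm
      apply Finset.sum_bij (fun j _ => q * j)
      · intro j hj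
        simp only [Finset.mem_filter, Finset.mem_range] at hj ⊢
        exact ⟨⟨Nat.mul_lt_mul_of_pos_left hj.1 hqp.pos,
          fun p hp h => hj.2 p hp ((hcop p hp j).1 h)⟩, dvd_mul_right _ _⟩
      · intro a _ b _ h
        exact Nat.eq_of_mul_eq_mul_left hqp.pos h
      · intro b hb
        simp only [Finset.mem_filter, Finset.mem_range] at hb
        obtain ⟨⟨hb1, hb2⟩, j, rfl⟩ := hb
        refine ⟨j, ?_, rfl⟩
        simp only [Finset.mem_filter, Finset.mem_range]
        exact ⟨Nat.lt_of_mul_lt_mul_left hb1,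
          fun p hp h => hb2 p hp ((hcop p hp j).2 h)⟩
      · intro j _
        push_cast
        ring
    have h5 : (Finset.range (q * m)).filter (fun i => ∀ p ∈ insert q I, ¬ p ∣ i) =
        ((Finset.range (q * m)).filter (fun i => ∀ p ∈ I, ¬ p ∣ i)).filter
        (fun i => ¬ q ∣ i) := by
      ext i
      simp only [Finset.mem_filter, Finset.forall_mem_insert]
      tauto
    have hq0 : (q : ℚ) ≠ 0 := by exact_mod_cast hqp.ne_zero
    rw [h5, eq_sub_of_add_eq' h3, h4, h1, h2, Finset.prod_insert hq, Finset.prod_insert hq,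
      Finset.card_insert_of_notMem hq]
    generalize ∏ p ∈ I, (1 - 1 / (p : ℚ)) = P
    generalize ∏ p ∈ I, (p : ℚ) = R
    push_cast
    rw [pow_succ (-1 : ℚ) (I.card + 1)]
    generalize (-1 : ℚ) ^ (I.card + 1) = e
    field_simp
    ring

/-- For `n` positive and `I` a set of prime divisors of `n`,
`∑_{1 ≤ i ≤ n−1, p ∤ i ∀ p ∈ I} i(n−i)
  = (1/6)·n·(∏_{p ∈ I}(1 − 1/p))·(n² + (−1)^{|I|+1}·∏_{p ∈ I} p)` in `ℚ`. -/
theorem sum_coprime_to_set (n : ℕ) (hn : 0 < n) (I : Finset ℕ) (hI : I ⊆ n.primeFactors) :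
    ∑ i ∈ (Finset.Ico 1 n).filter (fun i => ∀ p ∈ I, ¬ p ∣ i), ((i : ℚ) * ((n : ℚ) - (i : ℚ))) =
      (1 / 6 : ℚ) * (n : ℚ) * (∏ p ∈ I, (1 - 1 / (p : ℚ))) *
        ((n : ℚ) ^ 2 + (-1 : ℚ) ^ (I.card + 1) * ∏ p ∈ I, (p : ℚ)) := by
  rw [← sum_main_aux I n hn hI]
  apply Finset.sum_subset
  · intro i hi
    simp only [Finset.mem_filter, Finset.mem_range, Finset.mem_Ico] at hi ⊢
    exact ⟨hi.1.2, hi.2⟩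
  · intro i hi hi'
    simp only [Finset.mem_filter, Finset.mem_range, Finset.mem_Ico] at hi hi'
    have : i = 0 := by
      by_contra h
      exact hi' ⟨⟨Nat.one_le_iff_ne_zero.2 h, hi.1⟩, hi.2⟩
    simp [this]
end

section
/- Let n ≥ 2 be an integer with exactly k distinct prime divisors p_1, …, p_k. Then, as rational numbers, Σ_{1 ≤ i ≤ n−1, gcd(i,n)=1} i(n−i) = (φ(n)/6)·(n² + (−1)^{k+1}·∏_{i=1}^{k} p_i), where φ is the Euler totient function. -/
theorem sc_sum_range (m : ℕ) (d : ℚ) :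
    ∑ j ∈ Finset.range m, (d * j) * (d * m - d * j) = d ^ 2 * ((m : ℚ) ^ 3 - m) / 6 := by
  have h : ∀ (c : ℚ), ∑ j ∈ Finset.range m, (d * j) * (d * c - d * j) =
      d ^ 2 * (c * (m * (m - 1) / 2) - m * (m - 1) * (2 * m - 1) / 6) := by
    intro c
    induction m with
    | zero => simp
    | succ k ih => rw [Finset.sum_range_succ, ih]; push_cast; ring
  rw [h]; ring

theorem sc_sum_dvd (n d : ℕ) (hd : d ∣ n) (hn : 0 < n) :
    ∑ i ∈ Finset.range n, (if d ∣ i then ((i : ℚ) * ((n : ℚ) - i)) else 0) =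
      ((n : ℚ) ^ 3 * (d : ℚ)⁻¹ - n * d) / 6 := by
  obtain ⟨m, rfl⟩ := hd
  have hd0 : 0 < d := Nat.pos_of_mul_pos_right hn
  rw [← Finset.sum_filter]
  have : (Finset.range (d * m)).filter (fun i => d ∣ i) =
      (Finset.range m).image (fun j => d * j) := by
    ext i
    simp only [Finset.mem_filter, Finset.mem_range, Finset.mem_image]
    constructor
    · rintro ⟨h, j, rfl⟩
      exact ⟨j, lt_of_mul_lt_mul_left h (Nat.zero_le _), rfl⟩
    · rintro ⟨j, h, rfl⟩
      exact ⟨Nat.mul_lt_mul_of_pos_left h hd0, dvd_mul_right _ _⟩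
  rw [this, Finset.sum_image (fun a _ b _ h => Nat.eq_of_mul_eq_mul_left hd0 h)]
  have h := sc_sum_range m d
  push_cast
  rw [h]
  have : (d : ℚ) ≠ 0 := by positivity
  field_simp

theorem sc_prod_ite (t : Finset ℕ) (ht : ∀ p ∈ t, p.Prime) (i : ℕ) :
    ∏ p ∈ t, (-(if p ∣ i then (1 : ℚ) else 0)) =
      (∏ p ∈ t, (-1 : ℚ)) * (if (∏ p ∈ t, p) ∣ i then 1 else 0) := by
  have : ∀ p ∈ t, (-(if p ∣ i then (1 : ℚ) else 0)) = (-1) * (if p ∣ i then (1 : ℚ) else 0) := by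
    intro p _; ring
  rw [Finset.prod_congr rfl this, Finset.prod_mul_distrib, Finset.prod_ite_zero]
  congr 1
  have : (∀ p ∈ t, p ∣ i) ↔ (∏ p ∈ t, p) ∣ i := by
    constructor
    · intro h
      exact Finset.prod_primes_dvd i (fun p hp => (ht p hp).prime) h
    · intro h p hp
      exact (Finset.dvd_prod_of_mem _ hp).trans h
  simp [this]

/-- For `n ≥ 2` with exactly `k` distinct prime divisors,
`∑_{1 ≤ i ≤ n−1, gcd(i,n)=1} i(n−i) = (φ(n)/6)·(n² + (−1)^{k+1}·∏ p)` in `ℚ`,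
where the product runs over the distinct prime divisors of `n`. -/
theorem sum_coprime (n : ℕ) (hn : 2 ≤ n) (k : ℕ) (hk : k = n.primeFactors.card) :
    ∑ i ∈ (Finset.Ico 1 n).filter (fun i => Nat.gcd i n = 1), ((i : ℚ) * ((n : ℚ) - (i : ℚ))) =
      ((n.totient : ℚ) / 6) *
        ((n : ℚ) ^ 2 + (-1 : ℚ) ^ (k + 1) * ∏ p ∈ n.primeFactors, (p : ℚ)) := by
  have hn0 : n ≠ 0 := by omega
  have hpr : ∀ p ∈ n.primeFactors, p.Prime := fun p hp => Nat.prime_of_mem_primeFactors hp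
  have hind : ∀ i : ℕ, (if Nat.gcd i n = 1 then (1 : ℚ) else 0) =
      ∏ p ∈ n.primeFactors, (1 + -(if p ∣ i then (1 : ℚ) else 0)) := by
    intro i
    split_ifs with h
    · symm
      apply Finset.prod_eq_one
      intro p hp
      have : ¬ p ∣ i := fun hpi => (hpr p hp).one_lt.ne'
        (Nat.dvd_one.mp (h ▸ Nat.dvd_gcd hpi (Nat.dvd_of_mem_primeFactors hp)))
      simp [this]
    · symm
      obtain ⟨p, hp, hpd⟩ := Nat.exists_prime_and_dvd h
      apply Finset.prod_eq_zero (i := p)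
      · exact Nat.mem_primeFactors.mpr ⟨hp, hpd.trans (Nat.gcd_dvd_right _ _), hn0⟩
      · simp [hpd.trans (Nat.gcd_dvd_left _ _)]
  have h1 : ∑ i ∈ (Finset.Ico 1 n).filter (fun i => Nat.gcd i n = 1),
      ((i : ℚ) * ((n : ℚ) - (i : ℚ))) =
      ∑ i ∈ Finset.range n, (if Nat.gcd i n = 1 then (1 : ℚ) else 0) * ((i : ℚ) * ((n : ℚ) - i)) := by
    rw [Finset.sum_filter, Finset.range_eq_Ico, Finset.sum_eq_sum_Ico_succ_bot (by omega : 0 < n)]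
    simp
  have h2 : ∀ i : ℕ, (if Nat.gcd i n = 1 then (1 : ℚ) else 0) * ((i : ℚ) * ((n : ℚ) - i)) =
      ∑ t ∈ n.primeFactors.powerset, (∏ p ∈ t, (-1 : ℚ)) *
        (if (∏ p ∈ t, p) ∣ i then ((i : ℚ) * ((n : ℚ) - i)) else 0) := by
    intro i
    rw [hind, Finset.prod_one_add, Finset.sum_mul]
    refine Finset.sum_congr rfl fun t ht => ?_
    rw [sc_prod_ite t (fun p hp => hpr p (Finset.mem_powerset.mp ht hp))]
    split_ifs <;> ring
  rw [h1, Finset.sum_congr rfl fun i _ => h2 i, Finset.sum_comm]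
  have h3 : ∀ t ∈ n.primeFactors.powerset, ∑ i ∈ Finset.range n, (∏ p ∈ t, (-1 : ℚ)) *
        (if (∏ p ∈ t, p) ∣ i then ((i : ℚ) * ((n : ℚ) - i)) else 0) =
      (n : ℚ) ^ 3 / 6 * ∏ p ∈ t, (-(p : ℚ)⁻¹) - n / 6 * ∏ p ∈ t, (-(p : ℚ)) := by
    intro t ht
    have htn : (∏ p ∈ t, p) ∣ n :=
      (Finset.prod_dvd_prod_of_subset _ _ _ (Finset.mem_powerset.mp ht)).trans
        (Nat.prod_primeFactors_dvd n)
    rw [← Finset.mul_sum, sc_sum_dvd n _ htn (by omega)]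
    have e1 : ∏ p ∈ t, (-(p : ℚ)⁻¹) = (∏ p ∈ t, (-1 : ℚ)) * (∏ p ∈ t, (p : ℚ))⁻¹ := by
      rw [← Finset.prod_inv_distrib, ← Finset.prod_mul_distrib]
      exact Finset.prod_congr rfl fun p _ => by ring
    have e2 : ∏ p ∈ t, (-(p : ℚ)) = (∏ p ∈ t, (-1 : ℚ)) * (∏ p ∈ t, (p : ℚ)) := by
      rw [← Finset.prod_mul_distrib]
      exact Finset.prod_congr rfl fun p _ => by ring
    rw [e1, e2]
    push_cast
    ring
  rw [Finset.sum_congr rfl h3, Finset.sum_sub_distrib, ← Finset.mul_sum, ← Finset.mul_sum,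
    ← Finset.prod_one_add, ← Finset.prod_one_add, Nat.totient_eq_mul_prod_factors]
  have h4 : ∏ p ∈ n.primeFactors, (1 + -(p : ℚ)) =
      (-1) ^ k * (∏ p ∈ n.primeFactors, (p : ℚ)) * ∏ p ∈ n.primeFactors, (1 - (p : ℚ)⁻¹) := by
    rw [hk, ← Finset.prod_const, ← Finset.prod_mul_distrib, ← Finset.prod_mul_distrib]
    refine Finset.prod_congr rfl fun p hp => ?_
    have : (p : ℚ) ≠ 0 := by exact_mod_cast (hpr p hp).ne_zero
    field_simp
    ring
  rw [h4]
  simp only [← sub_eq_add_neg]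
  ring
end

section
/- Let ℓ ≥ 1 and m ≥ 2 be integers, and let q_1, …, q_t be the distinct prime divisors of m. Then, as rational numbers, (1/(4m²)) · (Σ_{1 ≤ i ≤ m−1, gcd(m,i)=1} i(m−i)) · (ℓ/φ(m)) = (ℓ/24)·(1 + (−1)^{t+1}·(∏_{i=1}^{t} q_i)/m²), where φ is the Euler totient function. -/
lemma aux_sum (n : ℕ) (d : ℚ) :
    ∑ j ∈ Finset.range n, (j : ℚ) * (d - j) = d * (n * (n - 1) / 2) - (n - 1) * n * (2 * n - 1) / 6 := by
  induction n with
  | zero => simp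
  | succ k ih => rw [Finset.sum_range_succ, ih]; push_cast; ring

lemma aux_dvd (m d : ℕ) (hd : d ∣ m) (hm : 0 < m) :
    ∑ i ∈ Finset.range m, (if d ∣ i then (i : ℚ) * (m - i) else 0)
      = ((m : ℚ) ^ 3 * (d : ℚ)⁻¹ - m * d) / 6 := by
  obtain ⟨n, rfl⟩ := hd
  have hd0 : 0 < d := Nat.pos_of_mul_pos_right hm
  rw [← Finset.sum_filter]
  have : (Finset.range (d * n)).filter (fun i => d ∣ i) = (Finset.range n).image (fun j => d * j) := by
    ext i
    simp only [Finset.mem_filter, Finset.mem_range, Finset.mem_image]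
    constructor
    · rintro ⟨h, j, rfl⟩
      exact ⟨j, Nat.lt_of_mul_lt_mul_left h, rfl⟩
    · rintro ⟨j, h, rfl⟩
      exact ⟨Nat.mul_lt_mul_of_pos_left h hd0, dvd_mul_right _ _⟩
  rw [this, Finset.sum_image (fun a _ b _ h => Nat.eq_of_mul_eq_mul_left hd0 h)]
  have h2 : ∀ j ∈ Finset.range n, (((d * j : ℕ) : ℚ) * (((d * n : ℕ) : ℚ) - ((d * j : ℕ) : ℚ)))
      = (d : ℚ) ^ 2 * ((j : ℚ) * ((n : ℚ) - j)) := by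
    intro j _; push_cast; ring
  rw [Finset.sum_congr rfl h2, ← Finset.mul_sum, aux_sum]
  have : (d : ℚ) ≠ 0 := by positivity
  push_cast
  field_simp
  ring

lemma aux_prod_dvd (m i : ℕ) (S : Finset ℕ) (hS : S ⊆ m.primeFactors) :
    (∏ p ∈ S, p) ∣ i ↔ ∀ p ∈ S, p ∣ i := by
  constructor
  · intro h p hp
    exact (Finset.dvd_prod_of_mem _ hp).trans h
  · intro h
    exact Finset.prod_primes_dvd i
      (fun p hp => (Nat.prime_of_mem_primeFactors (hS hp)).prime) h

lemma aux_ind (m i : ℕ) (hm : m ≠ 0) :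
    (if Nat.gcd m i = 1 then (1 : ℚ) else 0)
      = ∑ S ∈ m.primeFactors.powerset, (-1) ^ S.card * (if (∏ p ∈ S, p) ∣ i then 1 else 0) := by
  have h1 : (if Nat.gcd m i = 1 then (1 : ℚ) else 0)
      = ∏ p ∈ m.primeFactors, (1 + -(if p ∣ i then (1 : ℚ) else 0)) := by
    split_ifs with h
    · symm
      apply Finset.prod_eq_one
      intro p hp
      have hpp := Nat.prime_of_mem_primeFactors hp
      have : ¬ p ∣ i := fun hpi => hpp.one_lt.ne'
        (Nat.dvd_one.mp (h ▸ Nat.dvd_gcd (Nat.dvd_of_mem_primeFactors hp) hpi))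
      simp [this]
    · symm
      obtain ⟨p, hp, hpd⟩ := Nat.exists_prime_and_dvd h
      apply Finset.prod_eq_zero (i := p)
      · exact Nat.mem_primeFactors.mpr ⟨hp, hpd.trans (Nat.gcd_dvd_left _ _), hm⟩
      · simp [hpd.trans (Nat.gcd_dvd_right _ _)]
  rw [h1, Finset.prod_one_add]
  apply Finset.sum_congr rfl
  intro S hS
  rw [Finset.prod_neg]
  congr 1
  rw [Finset.prod_ite_zero]
  simp only [aux_prod_dvd m i S (Finset.mem_powerset.mp hS), Finset.prod_const_one]

lemma aux_main (m : ℕ) (hm : 2 ≤ m) :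
    ∑ i ∈ (Finset.Ico 1 m).filter (fun i => Nat.gcd m i = 1), ((i : ℚ) * ((m : ℚ) - (i : ℚ)))
      = ((m : ℚ) ^ 3 * ∏ p ∈ m.primeFactors, (1 - (p : ℚ)⁻¹)
          - m * ∏ p ∈ m.primeFactors, (1 - (p : ℚ))) / 6 := by
  have h0 : ∑ i ∈ (Finset.Ico 1 m).filter (fun i => Nat.gcd m i = 1), ((i : ℚ) * ((m : ℚ) - (i : ℚ)))
      = ∑ i ∈ Finset.range m, (if Nat.gcd m i = 1 then (1 : ℚ) else 0) * ((i : ℚ) * ((m : ℚ) - i)) := by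
    rw [Finset.sum_filter, Finset.range_eq_Ico, Finset.sum_eq_sum_Ico_succ_bot (by omega : 0 < m)]
    simp
  have e1 : ∏ p ∈ m.primeFactors, (1 - (p : ℚ)⁻¹)
      = ∑ S ∈ m.primeFactors.powerset, (-1) ^ S.card * ((∏ p ∈ S, p : ℕ) : ℚ)⁻¹ := by
    simp_rw [sub_eq_add_neg]
    rw [Finset.prod_one_add]
    refine Finset.sum_congr rfl fun S _ => ?_
    rw [Finset.prod_neg]; simp
  have e2 : ∏ p ∈ m.primeFactors, (1 - (p : ℚ))
      = ∑ S ∈ m.primeFactors.powerset, (-1) ^ S.card * ((∏ p ∈ S, p : ℕ) : ℚ) := by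
    simp_rw [sub_eq_add_neg]
    rw [Finset.prod_one_add]
    refine Finset.sum_congr rfl fun S _ => ?_
    rw [Finset.prod_neg]; simp
  rw [h0, e1, e2]
  simp_rw [aux_ind m _ (by omega : m ≠ 0), Finset.sum_mul]
  rw [Finset.sum_comm, Finset.mul_sum, Finset.mul_sum, ← Finset.sum_sub_distrib, Finset.sum_div]
  refine Finset.sum_congr rfl fun S hS => ?_
  have hd : (∏ p ∈ S, p) ∣ m := (aux_prod_dvd m m S (Finset.mem_powerset.mp hS)).mpr
    fun p hp => Nat.dvd_of_mem_primeFactors (Finset.mem_powerset.mp hS hp)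
  have := aux_dvd m _ hd (by omega)
  simp_rw [mul_assoc, ← Finset.mul_sum, ite_mul, one_mul, zero_mul]
  rw [this]; ring


/-- For `ℓ ≥ 1`, `m ≥ 2` with `t` distinct prime divisors `q_1, …, q_t`,
`(1/(4m²)) · (∑_{1 ≤ i ≤ m−1, gcd(m,i)=1} i(m−i)) · (ℓ/φ(m))
  = (ℓ/24)·(1 + (−1)^{t+1}·(∏ q_i)/m²)` in `ℚ`. -/
theorem conformal_weight_formula (ℓ m : ℕ) (hℓ : 1 ≤ ℓ) (hm : 2 ≤ m)
    (t : ℕ) (ht : t = m.primeFactors.card) :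
    (1 / (4 * (m : ℚ) ^ 2)) *
      (∑ i ∈ (Finset.Ico 1 m).filter (fun i => Nat.gcd m i = 1), ((i : ℚ) * ((m : ℚ) - (i : ℚ)))) *
      ((ℓ : ℚ) / (m.totient : ℚ)) =
    ((ℓ : ℚ) / 24) *
      (1 + (-1 : ℚ) ^ (t + 1) * (∏ q ∈ m.primeFactors, (q : ℚ)) / (m : ℚ) ^ 2) := by
  subst ht
  rw [aux_main m hm]
  have hphi := Nat.totient_eq_mul_prod_factors m
  have hφ : (m.totient : ℚ) ≠ 0 := by
    have := Nat.totient_pos.mpr (by omega : 0 < m)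
    positivity
  have e : ∏ p ∈ m.primeFactors, (1 - (p : ℚ)) = (-1) ^ m.primeFactors.card *
      (∏ p ∈ m.primeFactors, (p : ℚ)) * ∏ p ∈ m.primeFactors, (1 - (p : ℚ)⁻¹) := by
    rw [← Finset.prod_neg, ← Finset.prod_mul_distrib]
    refine Finset.prod_congr rfl fun p hp => ?_
    have : (p : ℚ) ≠ 0 := by exact_mod_cast (Nat.prime_of_mem_primeFactors hp).ne_zero
    field_simp
    ring
  have hm0 : (m : ℚ) ≠ 0 := by positivity
  rw [e]
  rw [hphi] at hφ ⊢
  generalize ∏ p ∈ m.primeFactors, (1 - (p : ℚ)⁻¹) = P at *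
  have hP : P ≠ 0 := right_ne_zero_of_mul hφ
  field_simp
  ring
end

section
/- Let m ≥ 2 be an integer with exactly t distinct prime divisors q_1, …, q_t, and set A = m²/(∏_{i=1}^{t} q_i) (an integer). If (A + (−1)^{t+1}) divides 24·A, then m is prime, m ∈ {2, 3, 5, 7, 11, 23}, and the corresponding value ℓ = 24·A/(A + (−1)^{t+1}) equals 16, 18, 20, 21, 22, 23 respectively. -/
/-- Let `m ≥ 2` have exactly `t` distinct prime divisors and set
`A = m²/rad(m)`. If `(A + (−1)^{t+1}) ∣ 24·A`, then `m` is prime,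
`m ∈ {2,3,5,7,11,23}`, and `ℓ = 24·A/(A + (−1)^{t+1})` equals `16, 18, 20, 21, 22, 23`
respectively. -/
theorem case_two_rank_constraint (m : ℕ) (hm : 2 ≤ m) (t : ℕ)
    (ht : t = m.primeFactors.card)
    (A : ℤ) (hA : A = (m : ℤ) ^ 2 / ∏ p ∈ m.primeFactors, (p : ℤ))
    (hdvd : (A + (-1) ^ (t + 1)) ∣ 24 * A)
    (ℓ : ℤ) (hℓ : ℓ = 24 * A / (A + (-1) ^ (t + 1))) :
    m.Prime ∧ m ∈ ({2, 3, 5, 7, 11, 23} : Finset ℕ) ∧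
    (m = 2 → ℓ = 16) ∧ (m = 3 → ℓ = 18) ∧ (m = 5 → ℓ = 20) ∧
    (m = 7 → ℓ = 21) ∧ (m = 11 → ℓ = 22) ∧ (m = 23 → ℓ = 23) := by
  have hprod : (∏ p ∈ m.primeFactors, (p : ℤ)) = ((∏ p ∈ m.primeFactors, p : ℕ) : ℤ) := by
    push_cast; rfl
  have hm25 : m ≤ 25 := by
    obtain ⟨k, hk⟩ := Nat.prod_primeFactors_dvd m
    have hpos : 0 < ∏ p ∈ m.primeFactors, p :=
      Finset.prod_pos fun p hp => (Nat.prime_of_mem_primeFactors hp).pos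
    rw [hprod] at hA
    generalize (∏ p ∈ m.primeFactors, p) = r at *
    have hk0 : 0 < k := by
      rcases Nat.eq_zero_or_pos k with h | h
      · subst h; omega
      · exact h
    have hAm : A = (m : ℤ) * k := by
      rw [hA]
      apply Int.ediv_eq_of_eq_mul_right (by exact_mod_cast hpos.ne')
      have : (m : ℤ) = r * k := by exact_mod_cast hk
      rw [sq]
      nth_rewrite 2 [this]
      ring
    have hge : (m : ℤ) ≤ A := by
      rw [hAm]
      have : (1 : ℤ) ≤ k := by exact_mod_cast hk0
      nlinarith
    rcases neg_one_pow_eq_or ℤ (t + 1) with h | h <;> rw [h] at hdvd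
    · have h24 : A + 1 ∣ 24 := by
        have := dvd_sub (Dvd.intro_left (24 : ℤ) rfl : A + 1 ∣ 24 * (A + 1)) hdvd
        ring_nf at this ⊢
        exact this
      have := Int.le_of_dvd (by norm_num) h24
      omega
    · have h24 : A + -1 ∣ 24 := by
        have := dvd_sub hdvd (Dvd.intro_left (24 : ℤ) rfl : A + -1 ∣ 24 * (A + -1))
        ring_nf at this ⊢
        exact this
      have := Int.le_of_dvd (by norm_num) h24
      omega
  rw [hprod] at hA
  clear hprod
  subst ht hℓ hA
  revert hdvd
  interval_cases m <;> simp [Nat.primeFactors] <;> norm_num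
end
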